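/- Let F ∈ ℤ[x₁,…,xₙ] be a form of degree d ≥ 3 with singular locus over ℚ of dimension σ, let ω ∈ 𝒮⁺(𝐜), let 0 < Δ < d/3, and assume n − σ > (3/4)·d·2^d − 2d. Then there exist δ > 0 and i ∈ {1, 2} such that for all P ≥ 2: Σ_{P^{Δᵢ} ≤ q ≤ P^ξ} ∫_{ {α : P^{−dᵢ} ≤ ‖qα‖ ≤ P^{−ξ}} } M(α, q)^{n−σ} dα ≪ P^{−d−δ} + Σ_{q : P^{γᵢ} ≤ η_q ≤ P^γ} ∫_{ {α : P^{−dᵢ} ≤ ‖qα‖ ≤ P^{−ξ}} } M*(α, q)^{n−σ} dα, where Δ₁ := Δ, Δ₂ := 0, d₁ := d + 2, d₂ := d − Δ, γᵢ := Δᵢ/(5·2^{d−2} − 4), and the implicit constant depends only on Δ, d and n. -/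

import Mathlib

noncomputable section
open scoped Classical
open MvPolynomial MeasureTheory

/-- Distance from a real number to the nearest integer. -/
def nint (x : ℝ) : ℝ := |x - round x|

/-- `α ∈ 𝕋` and `q ∈ ℕ` are *primitive* if there is `a` coprime to `q`
with `‖qα‖ = |qα - a|`. -/
def Primitive (α : ℝ) (q : ℕ) : Prop :=
  ∃ a : ℤ, Int.gcd a q = 1 ∧ nint (q * α) = |q * α - a|

/-- `e(t) = exp(2πit)`. -/
def eC (t : ℝ) : ℂ := Complex.exp (2 * Real.pi * Complex.I * t)

/-- The exponential sum `S(α, P) = Σ_{x ∈ ℤⁿ} ω(x/P) e(α f(x))`. -/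
def expSum (n : ℕ) (f : MvPolynomial (Fin n) ℤ) (ω : (Fin n → ℝ) → ℝ) (α P : ℝ) : ℂ :=
  ∑' x : Fin n → ℤ, (ω (fun i => (x i : ℝ) / P) : ℂ) * eC (α * (MvPolynomial.eval x f : ℝ))

/-- Mixed partial derivative `∂^ε g`. -/
def mpderiv (n : ℕ) (ε : Fin n → ℕ) (g : (Fin n → ℝ) → ℝ) : (Fin n → ℝ) → ℝ :=
  (List.finRange n).foldr
    (fun i h => (fun u : (Fin n → ℝ) → ℝ => fun x => fderiv ℝ u x (Pi.single i 1))^[ε i] h) g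

/-- A super-exponential increasing tuple of positive constants `(c, c₀, c₁, …)`. -/
def SuperSeq (c : ℝ) (cs : ℕ → ℝ) : Prop :=
  0 < c ∧ c ≤ cs 0 ∧ Monotone cs ∧ ∀ i j, cs i * cs j ≤ cs (i + j)

/-- Membership of `ω` in the class `𝒮⁺(𝐜)` of smooth weight functions. -/
def SmoothWeight (n : ℕ) (c : ℝ) (cs : ℕ → ℝ) (ω : (Fin n → ℝ) → ℝ) : Prop :=
  ContDiff ℝ (⊤ : ℕ∞) ω ∧ (∀ x, 0 ≤ ω x) ∧ (∀ x, ω x ≠ 0 → ∀ i, |x i| ≤ c) ∧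
    ∀ (ε : Fin n → ℕ) (x : Fin n → ℝ), |mpderiv n ε ω x| ≤ cs (∑ i, ε i)

/-- Dimension of the singular locus of `g` over `K`, i.e. the Krull dimension
of the coordinate ring of the affine set cut out by `∇g = 0`. -/
def singDim (n : ℕ) (K : Type) [CommRing K] (g : MvPolynomial (Fin n) K) : WithBot (WithTop ℕ) :=
  ringKrullDim (MvPolynomial (Fin n) K ⧸ Ideal.span (Set.range fun i => MvPolynomial.pderiv i g))

/-- `Height f ≤ H`: all coefficients of `f` are at most `H` in absolute value. -/
def HeightLe (n : ℕ) (f : MvPolynomial (Fin n) ℤ) (H : ℝ) : Prop :=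
  ∀ m : Fin n →₀ ℕ, |((f.coeff m : ℤ) : ℝ)| ≤ H

/-- `Height_{P,k} f ≤ H`: the relative height of `f` w.r.t. `P` at scale `k` is at most `H`. -/
def HeightPLe (n k : ℕ) (P : ℝ) (f : MvPolynomial (Fin n) ℤ) (H : ℝ) : Prop :=
  ∀ m : Fin n →₀ ℕ, |((f.coeff m : ℤ) : ℝ)| * P ^ (m.sum fun _ e => e) ≤ H * P ^ k

/-- `b = ∏_{p^e ∥ q, e ≤ 2} p^e`. -/
def bOf (q : ℕ) : ℕ :=
  ∏ p ∈ q.primeFactors, if q.factorization p ≤ 2 then p ^ q.factorization p else 1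

/-- `c₁ = ∏_{p^e ∥ q, e > 2} p^⌊e/2⌋`. -/
def c1Of (q : ℕ) : ℕ :=
  ∏ p ∈ q.primeFactors, if 2 < q.factorization p then p ^ (q.factorization p / 2) else 1

/-- `c₂ = ∏_{p^e ∥ q, e > 2, e odd} p`. -/
def c2Of (q : ℕ) : ℕ :=
  ∏ p ∈ q.primeFactors, if 2 < q.factorization p ∧ Odd (q.factorization p) then p else 1

/-- `η_q = max{(b³c₁c₂²)^{1/(2^d−2)}, (b³c₁²c₂)^{1/(5·2^{d−2}−4)}}`. -/
def etaOf (d q : ℕ) : ℝ :=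
  max (((bOf q : ℝ) ^ 3 * (c1Of q : ℝ) * (c2Of q : ℝ) ^ 2) ^ ((1 : ℝ) / ((2:ℝ) ^ (d : ℝ) - 2)))
      (((bOf q : ℝ) ^ 3 * (c1Of q : ℝ) ^ 2 * (c2Of q : ℝ)) ^
        ((1 : ℝ) / (5 * (2:ℝ) ^ ((d : ℝ) - 2) - 4)))

/-- The `r`-values `r_i = ∏_{p^e ∥ kb, σ_p(g^{[k]}) = i} p^e` of `g` w.r.t. `q`. -/
def rOf (n k q : ℕ) (g : MvPolynomial (Fin n) ℤ) (i : ℕ) : ℕ :=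
  ∏ p ∈ (k * bOf q).primeFactors,
    if singDim n (ZMod p)
        (MvPolynomial.map (Int.castRingHom (ZMod p)) (MvPolynomial.homogeneousComponent k g))
        = (i : WithBot (WithTop ℕ))
    then p ^ ((k * bOf q).factorization p) else 1

/-- `R^{[k]}_ζ(g, q) = ∏_{ζ ≤ i ≤ n} r_i^{i−ζ}`. -/
def ROf (n k q : ℕ) (g : MvPolynomial (Fin n) ℤ) (ζ : ℕ) : ℕ :=
  ∏ i ∈ Finset.Icc ζ n, (rOf n k q g i) ^ (i - ζ)

/-- `ξ = (5 − 2^{4−d})/(3 − 2^{3−d})`. -/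
def xiOf (d : ℕ) : ℝ := (5 - (2:ℝ) ^ ((4 : ℝ) - d)) / (3 - (2:ℝ) ^ ((3 : ℝ) - d))

/-- `γ = 1/(3·2^{d−2} − 2)`. -/
def gamOf (d : ℕ) : ℝ := 1 / (3 * (2:ℝ) ^ ((d : ℝ) - 2) - 2)

/-- `A_d = 7·2^{d−4} − 5/4`. -/
def AdOf (d : ℕ) : ℝ := 7 * (2:ℝ) ^ ((d : ℝ) - 4) - 5 / 4

/-- `B_k = (k−1)·2^{d−1}`. -/
def BkOf (d k : ℕ) : ℝ := ((k : ℝ) - 1) * (2:ℝ) ^ ((d : ℝ) - 1)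

/-- `V_k = 2^{d+1−k} − 2`. -/
def VkOf (d k : ℕ) : ℝ := (2:ℝ) ^ ((d : ℝ) + 1 - (k : ℝ)) - 2

/-- `C(α, q) = (‖qα‖P)^{1/(2^{d−1}−2)} + (qP^{−2})^{1/2^{d−2}} + η_q⁻¹`. -/
def CCof (d : ℕ) (P : ℝ) (q : ℕ) (α : ℝ) : ℝ :=
  (nint (q * α) * P) ^ (1 / ((2:ℝ) ^ ((d : ℝ) - 1) - 2)) +
    ((q : ℝ) * P ^ (-(2 : ℝ))) ^ (1 / (2:ℝ) ^ ((d : ℝ) - 2)) + (etaOf d q)⁻¹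

/-- `W_k(α, q)`; the term `(‖qα‖P^k)^{−1/B_k}` is interpreted as `+∞` when `‖qα‖ = 0`. -/
def WWof (d k : ℕ) (P : ℝ) (q : ℕ) (α : ℝ) : ℝ :=
  P ^ (-((2:ℝ) ^ (1 - (d : ℝ)))) + nint (q * α) ^ (1 / (BkOf d k + VkOf d k)) +
    ((q : ℝ) * P ^ (-(k : ℝ))) ^ (1 / BkOf d k) +
    min ((q : ℝ) ^ (-(1 / (BkOf d k + VkOf d k))))
      (if nint (q * α) = 0 then (q : ℝ) ^ (-(1 / (BkOf d k + VkOf d k)))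
       else (nint (q * α) * P ^ (k : ℝ)) ^ (-(1 / BkOf d k)))

/-- `M(α, q) = min{C(α, q), W₃(α, q), …, W_d(α, q)}`. -/
def MMof (d : ℕ) (P : ℝ) (q : ℕ) (α : ℝ) : ℝ :=
  min (CCof d P q α) (sInf ((fun k => WWof d k P q α) '' Set.Icc 3 d))

/-- `W_k*(α, q)`; the term `(‖qα‖P^k)^{−1/B_k}` is interpreted as `+∞` when `‖qα‖ = 0`. -/
def WSof (d k : ℕ) (P : ℝ) (q : ℕ) (α : ℝ) : ℝ :=
  max (nint (q * α) ^ (1 / (BkOf d k + VkOf d k)))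
    (min ((etaOf d q)⁻¹)
      (if nint (q * α) = 0 then (etaOf d q)⁻¹
       else (nint (q * α) * P ^ (k : ℝ)) ^ (-(1 / BkOf d k))))

/-- `M*(α, q) = min{W₃*(α, q), …, W_d*(α, q)}`. -/
def MSof (d : ℕ) (P : ℝ) (q : ℕ) (α : ℝ) : ℝ :=
  sInf ((fun k => WSof d k P q α) '' Set.Icc 3 d)

/-- The major arcs `𝔐(Δ)`, viewed inside a fundamental domain `[0,1)` for `𝕋 = ℝ/ℤ`. -/
def majorArcs (d : ℕ) (Δ P : ℝ) : Set ℝ :=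
  {α | ∃ q : ℕ, 0 < q ∧ (q : ℝ) ≤ P ^ Δ ∧
    ∃ a : ℕ, a ≤ q ∧ Nat.gcd a q = 1 ∧ nint (α - (a : ℝ) / q) ≤ P ^ (Δ - d)}

/-- The minor arcs `𝔪 = 𝕋 ∖ 𝔐(Δ)`. -/
def minorArcs (d : ℕ) (Δ P : ℝ) : Set ℝ := Set.Ico (0 : ℝ) 1 \ majorArcs d Δ P



lemma nint_nonneg (x : ℝ) : 0 ≤ nint x := abs_nonneg _

lemma nint_le_one (x : ℝ) : nint x ≤ 1 := (abs_sub_round x).trans (by norm_num)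

lemma measurable_nint : Measurable nint := by
  have h : nint = fun x : ℝ => |x - (⌊x + 1 / 2⌋ : ℤ)| := by
    funext x
    rw [nint, round_eq]
  rw [h]
  fun_prop

lemma one_le_bOf (q : ℕ) : 1 ≤ bOf q := by
  refine Finset.one_le_prod' fun p hp => ?_
  split_ifs
  exacts [Nat.one_le_pow _ _ (Nat.prime_of_mem_primeFactors hp).pos, le_rfl]

lemma one_le_c1Of (q : ℕ) : 1 ≤ c1Of q := by
  refine Finset.one_le_prod' fun p hp => ?_
  split_ifs
  exacts [Nat.one_le_pow _ _ (Nat.prime_of_mem_primeFactors hp).pos, le_rfl]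

lemma one_le_c2Of (q : ℕ) : 1 ≤ c2Of q := by
  refine Finset.one_le_prod' fun p hp => ?_
  split_ifs
  exacts [(Nat.prime_of_mem_primeFactors hp).one_le, le_rfl]

lemma bOf_mul_c1Of_sq_mul_c2Of {q : ℕ} (hq : q ≠ 0) : bOf q * c1Of q ^ 2 * c2Of q = q := by
  conv_rhs => rw [← Nat.prod_factorization_pow_eq_self hq]
  rw [bOf, c1Of, c2Of, ← Finset.prod_pow, ← Finset.prod_mul_distrib, ← Finset.prod_mul_distrib,
    Finsupp.prod, Nat.support_factorization]
  refine Finset.prod_congr rfl fun p _ => ?_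
  rcases le_or_gt (q.factorization p) 2 with h | h
  · simp [h, not_lt.mpr h]
  · rcases Nat.even_or_odd' (q.factorization p) with ⟨m, hm | hm⟩
    · have ho : ¬ Odd (q.factorization p) := by simp [hm]
      have h2 : q.factorization p / 2 = m := by omega
      simp only [h, not_le.mpr h, ho, if_true, if_false, and_false, h2]
      rw [hm]; ring
    · have ho : Odd (q.factorization p) := ⟨m, hm⟩
      have h2 : q.factorization p / 2 = m := by omega
      simp only [h, not_le.mpr h, ho, if_true, if_false, and_self, h2]
      rw [hm]; ring

lemma two_rpow_sub_one (d : ℝ) : (2:ℝ) ^ (d - 1) = 2 * (2:ℝ) ^ (d - 2) := by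
  rw [show d - 1 = 1 + (d - 2) by ring, Real.rpow_add two_pos, Real.rpow_one]

lemma two_rpow_eq (d : ℝ) : (2:ℝ) ^ d = 4 * (2:ℝ) ^ (d - 2) := by
  rw [show d = 2 + (d - 2) by ring, Real.rpow_add two_pos]
  norm_num

lemma sub_one_le_two_rpow {d : ℕ} (hd : 3 ≤ d) : (d : ℝ) - 1 ≤ (2:ℝ) ^ ((d : ℝ) - 2) := by
  obtain ⟨m, rfl⟩ : ∃ m, d = m + 2 := ⟨d - 2, by omega⟩
  have h : m + 1 ≤ 2 ^ m := Nat.lt_two_pow_self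
  have h' : (m : ℝ) + 1 ≤ 2 ^ m := by exact_mod_cast h
  push_cast
  rw [add_sub_cancel_right, Real.rpow_natCast]
  linarith

lemma two_le_two_rpow {d : ℕ} (hd : 3 ≤ d) : 2 ≤ (2:ℝ) ^ ((d : ℝ) - 2) := by
  have h : (3 : ℝ) ≤ d := by exact_mod_cast hd
  linarith [sub_one_le_two_rpow hd]

lemma xiOf_eq {d : ℕ} (hd : 3 ≤ d) :
    xiOf d = 1 + (2 * (2:ℝ) ^ ((d : ℝ) - 2) - 2) / (3 * (2:ℝ) ^ ((d : ℝ) - 2) - 2) := by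
  have hX := two_le_two_rpow hd
  have h4 : (2:ℝ) ^ ((4 : ℝ) - d) = 4 / (2:ℝ) ^ ((d : ℝ) - 2) := by
    rw [eq_div_iff (by positivity), ← Real.rpow_add two_pos,
      show (4 : ℝ) - d + (d - 2) = (2 : ℕ) by push_cast; ring, Real.rpow_natCast]
    norm_num
  have h3 : (2:ℝ) ^ ((3 : ℝ) - d) = 2 / (2:ℝ) ^ ((d : ℝ) - 2) := by
    rw [eq_div_iff (by positivity), ← Real.rpow_add two_pos,
      show (3 : ℝ) - d + (d - 2) = 1 by ring, Real.rpow_one]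
  rw [xiOf, h4, h3]
  set X := (2:ℝ) ^ ((d : ℝ) - 2)
  have h1 : 3 * X - 2 ≠ 0 := by linarith
  have h2 : X ≠ 0 := by linarith
  rw [show 3 - 2 / X = (3 * X - 2) / X by field_simp,
    show 5 - 4 / X = (5 * X - 4) / X by field_simp, div_div_div_cancel_right₀ h2,
    one_add_div h1]
  ring

lemma le_etaOf_rpow_left {d : ℕ} (hd : 3 ≤ d) (q : ℕ) :
    (bOf q : ℝ) ^ 3 * (c1Of q : ℝ) * (c2Of q : ℝ) ^ 2 ≤
      etaOf d q ^ (4 * (2:ℝ) ^ ((d : ℝ) - 2) - 2) := by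
  have hX := two_le_two_rpow hd
  have h : _ ≤ etaOf d q := le_max_left _ _
  rw [one_div, Real.rpow_inv_le_iff_of_pos (by positivity)
    ((by positivity : (0:ℝ) ≤ _).trans h) (by rw [two_rpow_eq]; linarith), two_rpow_eq] at h
  exact h

lemma le_etaOf_rpow_right {d : ℕ} (hd : 3 ≤ d) (q : ℕ) :
    (bOf q : ℝ) ^ 3 * (c1Of q : ℝ) ^ 2 * (c2Of q : ℝ) ≤
      etaOf d q ^ (5 * (2:ℝ) ^ ((d : ℝ) - 2) - 4) := by
  have hX := two_le_two_rpow hd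
  have h : _ ≤ etaOf d q := le_max_right _ _
  rwa [one_div, Real.rpow_inv_le_iff_of_pos (by positivity)
    ((by positivity : (0:ℝ) ≤ _).trans h) (by linarith)] at h

lemma one_le_etaOf {d : ℕ} (hd : 3 ≤ d) (q : ℕ) : 1 ≤ etaOf d q := by
  have hX := two_le_two_rpow hd
  have hb : (1:ℝ) ≤ bOf q := by exact_mod_cast one_le_bOf q
  have h1 : (1:ℝ) ≤ c1Of q := by exact_mod_cast one_le_c1Of q
  have h2 : (1:ℝ) ≤ c2Of q := by exact_mod_cast one_le_c2Of q
  refine le_max_of_le_right (Real.one_le_rpow ?_ ?_)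
  · exact one_le_mul_of_one_le_of_one_le (one_le_mul_of_one_le_of_one_le (one_le_pow₀ hb)
      (one_le_pow₀ h1)) h2
  · have : 0 < 5 * (2:ℝ) ^ ((d : ℝ) - 2) - 4 := by linarith
    positivity

lemma natCast_le_etaOf_rpow {d : ℕ} (hd : 3 ≤ d) {q : ℕ} (hq : q ≠ 0) :
    (q : ℝ) ≤ etaOf d q ^ (5 * (2:ℝ) ^ ((d : ℝ) - 2) - 4) := by
  refine le_trans ?_ (le_etaOf_rpow_right hd q)
  have hb : (1:ℝ) ≤ bOf q := by exact_mod_cast one_le_bOf q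
  have h : (q : ℝ) = bOf q * c1Of q ^ 2 * c2Of q := by
    exact_mod_cast (bOf_mul_c1Of_sq_mul_c2Of hq).symm
  rw [h]
  gcongr
  exact le_self_pow₀ hb (by norm_num)

lemma bOf_sq_mul_le_etaOf_rpow {d : ℕ} (hd : 3 ≤ d) (q : ℕ) :
    (bOf q : ℝ) ^ 2 * c1Of q * c2Of q ≤ etaOf d q ^ (3 * (2:ℝ) ^ ((d : ℝ) - 2) - 2) := by
  have hη : 0 < etaOf d q := one_pos.trans_le (one_le_etaOf hd q)
  refine le_of_pow_le_pow_left₀ (n := 3) (by norm_num) (by positivity) ?_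
  calc ((bOf q : ℝ) ^ 2 * c1Of q * c2Of q) ^ 3
      = ((bOf q : ℝ) ^ 3 * (c1Of q : ℝ) * (c2Of q : ℝ) ^ 2) *
          ((bOf q : ℝ) ^ 3 * (c1Of q : ℝ) ^ 2 * (c2Of q : ℝ)) := by ring
    _ ≤ etaOf d q ^ (4 * (2:ℝ) ^ ((d : ℝ) - 2) - 2) *
          etaOf d q ^ (5 * (2:ℝ) ^ ((d : ℝ) - 2) - 4) :=
        mul_le_mul (le_etaOf_rpow_left hd q) (le_etaOf_rpow_right hd q) (by positivity)
          (by positivity)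
    _ = (etaOf d q ^ (3 * (2:ℝ) ^ ((d : ℝ) - 2) - 2)) ^ 3 := by
        rw [← Real.rpow_natCast, ← Real.rpow_mul hη.le, ← Real.rpow_add hη]
        congr 1
        push_cast
        ring

/-- Rankin bound: `η_q ≤ P^γ` forces `b²c₁c₂ ≤ P`, so there are few such `q`. -/
lemma exists_card_etaOf_le (ε : ℝ) (hε : 0 < ε) :
    ∃ C : ℝ, 0 < C ∧ ∀ d : ℕ, 3 ≤ d → ∀ P : ℝ, 1 ≤ P → ∀ S : Finset ℕ,
      (∀ q ∈ S, q ≠ 0 ∧ etaOf d q ≤ P ^ gamOf d) → (S.card : ℝ) ≤ C * P ^ (1 + ε) := by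
  set f : ℕ → ℝ := fun m => (m : ℝ) ^ (-(1 + ε))
  have hf : Summable f := Real.summable_nat_rpow.mpr (by linarith)
  have hf0 : ∀ m, 0 ≤ f m := fun m => by positivity
  have hff : Summable fun x : ℕ × ℕ => f x.1 * f x.2 := hf.mul_of_nonneg hf hf0 hf0
  have hff0 : ∀ x : ℕ × ℕ, 0 ≤ f x.1 * f x.2 := fun x => by positivity
  have hfff : Summable fun x : ℕ × ℕ × ℕ => f x.1 * (f x.2.1 * f x.2.2) :=
    hf.mul_of_nonneg hff hf0 hff0
  have hT : 0 ≤ ∑' x : ℕ × ℕ × ℕ, f x.1 * (f x.2.1 * f x.2.2) :=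
    tsum_nonneg fun x => by positivity
  refine ⟨(∑' x : ℕ × ℕ × ℕ, f x.1 * (f x.2.1 * f x.2.2)) + 1, by positivity, ?_⟩
  intro d hd P hP S hS
  have hX := two_le_two_rpow hd
  have hP0 : 0 < P := by linarith
  set g : ℕ → ℕ × ℕ × ℕ := fun q => (bOf q, c1Of q, c2Of q)
  have hg : Set.InjOn g S := by
    intro x hx y hy hxy
    simp only [g, Prod.mk.injEq] at hxy
    rw [← bOf_mul_c1Of_sq_mul_c2Of (hS x hx).1, ← bOf_mul_c1Of_sq_mul_c2Of (hS y hy).1, hxy.1,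
      hxy.2.1, hxy.2.2]
  have hterm : ∀ q ∈ S, (1:ℝ) ≤ P ^ (1 + ε) * (f (g q).1 * (f (g q).2.1 * f (g q).2.2)) := by
    intro q hq
    have hη := one_le_etaOf hd q
    have hb : (1:ℝ) ≤ bOf q := by exact_mod_cast one_le_bOf q
    have h1 : (1:ℝ) ≤ c1Of q := by exact_mod_cast one_le_c1Of q
    have h2 : (1:ℝ) ≤ c2Of q := by exact_mod_cast one_le_c2Of q
    have hle : (bOf q : ℝ) * (c1Of q * c2Of q) ≤ P := by
      calc (bOf q : ℝ) * (c1Of q * c2Of q) ≤ (bOf q : ℝ) ^ 2 * (c1Of q * c2Of q) := by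
            gcongr
            exact le_self_pow₀ hb (by norm_num)
        _ = (bOf q : ℝ) ^ 2 * c1Of q * c2Of q := by ring
        _ ≤ etaOf d q ^ (3 * (2:ℝ) ^ ((d : ℝ) - 2) - 2) := bOf_sq_mul_le_etaOf_rpow hd q
        _ ≤ (P ^ gamOf d) ^ (3 * (2:ℝ) ^ ((d : ℝ) - 2) - 2) := by
            gcongr
            · linarith
            · exact (hS q hq).2
        _ = P := by
            rw [← Real.rpow_mul hP0.le, gamOf, one_div_mul_cancel (by linarith), Real.rpow_one]
    simp only [f, g]
    rw [← Real.mul_rpow (by positivity) (by positivity),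
      ← Real.mul_rpow (by positivity) (by positivity), Real.rpow_neg (by positivity),
      ← div_eq_mul_inv, one_le_div (by positivity)]
    exact Real.rpow_le_rpow (by positivity) hle (by positivity)
  calc (S.card : ℝ) = ∑ q ∈ S, (1:ℝ) := by simp
    _ ≤ ∑ q ∈ S, P ^ (1 + ε) * (f (g q).1 * (f (g q).2.1 * f (g q).2.2)) :=
        Finset.sum_le_sum hterm
    _ = P ^ (1 + ε) * ∑ x ∈ S.image g, f x.1 * (f x.2.1 * f x.2.2) := by
        rw [← Finset.mul_sum, Finset.sum_image hg]
    _ ≤ P ^ (1 + ε) * ∑' x : ℕ × ℕ × ℕ, f x.1 * (f x.2.1 * f x.2.2) := by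
        gcongr
        exact hfff.sum_le_tsum _ fun x _ => by positivity
    _ ≤ _ := by
        rw [mul_comm]
        gcongr
        linarith

/-- The set of `α ∈ [0, 1)` with `‖qα‖ ≤ t` is covered by `q + 1` intervals of length `2t/q`. -/
lemma volume_nint_le {q : ℕ} (hq : q ≠ 0) {t : ℝ} (ht : 0 ≤ t) :
    volume {α : ℝ | α ∈ Set.Ico (0 : ℝ) 1 ∧ nint (q * α) ≤ t} ≤ ENNReal.ofReal (4 * t) := by
  have hq1 : (1:ℝ) ≤ q := by exact_mod_cast Nat.one_le_iff_ne_zero.mpr hq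
  have hq0 : (0:ℝ) < q := by linarith
  have hsub : {α : ℝ | α ∈ Set.Ico (0 : ℝ) 1 ∧ nint (q * α) ≤ t} ⊆
      ⋃ a ∈ Finset.range (q + 1), Set.Icc ((a - t) / q : ℝ) ((a + t) / q) := by
    rintro α ⟨⟨h0, h1⟩, h⟩
    have hr := abs_le.mp (abs_sub_round ((q : ℝ) * α))
    have hlo : -1 < round ((q : ℝ) * α) := by
      have : (-1 : ℝ) < round ((q : ℝ) * α) := by
        have : 0 ≤ (q : ℝ) * α := by positivity
        linarith
      exact_mod_cast this
    have hhi : round ((q : ℝ) * α) < q + 1 := by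
      have : (round ((q : ℝ) * α) : ℝ) < q + 1 := by
        have : (q : ℝ) * α < q := by nlinarith
        linarith
      exact_mod_cast this
    obtain ⟨a, ha⟩ := Int.eq_ofNat_of_zero_le (show 0 ≤ round ((q : ℝ) * α) by omega)
    rw [nint, ha, abs_le] at h
    push_cast at h
    simp only [Set.mem_iUnion, Finset.mem_range]
    refine ⟨a, by omega, ?_, ?_⟩
    · rw [div_le_iff₀ hq0]; linarith
    · rw [le_div_iff₀ hq0]; linarith
  refine (measure_mono hsub).trans ((measure_biUnion_finset_le _ _).trans ?_)
  simp only [Real.volume_Icc]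
  have hlen : ∀ a : ℕ, ENNReal.ofReal ((a + t) / q - (a - t) / q) = ENNReal.ofReal (2 * t / q) := by
    intro a
    congr 1
    ring
  simp only [hlen, Finset.sum_const, Finset.card_range, nsmul_eq_mul]
  rw [← ENNReal.ofReal_natCast, ← ENNReal.ofReal_mul (by positivity)]
  refine ENNReal.ofReal_le_ofReal ?_
  rw [mul_div_assoc', div_le_iff₀ hq0]
  push_cast
  nlinarith

/-- The exponent `3/(9·2^{d−2} − 4)` for which `min{η_q⁻¹, (qP^{−k})^{1/B_k}} ≤ P^{−θ}`. -/
def thetaOf (d : ℕ) : ℝ := 3 / (9 * (2:ℝ) ^ ((d : ℝ) - 2) - 4)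

lemma BkOf_pos {d k : ℕ} (hk : 3 ≤ k) : 0 < BkOf d k := by
  have h : (3:ℝ) ≤ k := by exact_mod_cast hk
  exact mul_pos (by linarith) (by positivity)

lemma CCof_nonneg {d : ℕ} (hd : 3 ≤ d) {P : ℝ} (hP : 1 ≤ P) (q : ℕ) (α : ℝ) :
    0 ≤ CCof d P q α := by
  have hη := one_le_etaOf hd q
  have hn := nint_nonneg (q * α)
  unfold CCof
  positivity

lemma WWof_nonneg (d k : ℕ) {P : ℝ} (hP : 1 ≤ P) (q : ℕ) (α : ℝ) : 0 ≤ WWof d k P q α := by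
  have hn := nint_nonneg (q * α)
  have h : 0 ≤ min ((q : ℝ) ^ (-(1 / (BkOf d k + VkOf d k))))
      (if nint (q * α) = 0 then (q : ℝ) ^ (-(1 / (BkOf d k + VkOf d k)))
       else (nint (q * α) * P ^ (k : ℝ)) ^ (-(1 / BkOf d k))) := by
    refine le_min (by positivity) ?_
    split_ifs <;> positivity
  unfold WWof
  positivity

lemma MMof_nonneg {d : ℕ} (hd : 3 ≤ d) {P : ℝ} (hP : 1 ≤ P) (q : ℕ) (α : ℝ) :
    0 ≤ MMof d P q α := by
  refine le_min (CCof_nonneg hd hP q α) (Real.sInf_nonneg ?_)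
  rintro _ ⟨k, -, rfl⟩
  exact WWof_nonneg d k hP q α

lemma WSof_nonneg (d k : ℕ) (P : ℝ) (q : ℕ) (α : ℝ) : 0 ≤ WSof d k P q α :=
  le_max_of_le_left (Real.rpow_nonneg (nint_nonneg _) _)

lemma MSof_nonneg (d : ℕ) (P : ℝ) (q : ℕ) (α : ℝ) : 0 ≤ MSof d P q α := by
  refine Real.sInf_nonneg ?_
  rintro _ ⟨k, -, rfl⟩
  exact WSof_nonneg d k P q α

lemma exists_MSof_eq {d : ℕ} (hd : 3 ≤ d) (P : ℝ) (q : ℕ) (α : ℝ) :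
    ∃ k ∈ Set.Icc 3 d, WSof d k P q α = MSof d P q α :=
  ((Set.nonempty_Icc.mpr hd).image _).csInf_mem ((Set.finite_Icc 3 d).image _)

lemma MMof_le_WWof {d k : ℕ} (hk : k ∈ Set.Icc 3 d) (P : ℝ) (q : ℕ) (α : ℝ) :
    MMof d P q α ≤ WWof d k P q α :=
  (min_le_right _ _).trans
    (csInf_le ((Set.finite_Icc 3 d).image _).bddBelow (Set.mem_image_of_mem _ hk))

lemma VkOf_nonneg {d k : ℕ} (hk : k ≤ d) : 0 ≤ VkOf d k := by
  have h : (k : ℝ) ≤ d := by exact_mod_cast hk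
  have h2 : (2:ℝ) ^ (1:ℝ) ≤ (2:ℝ) ^ ((d : ℝ) + 1 - (k : ℝ)) :=
    Real.rpow_le_rpow_of_exponent_le one_le_two (by linarith)
  rw [Real.rpow_one] at h2
  unfold VkOf
  linarith

lemma WSof_le_one {d k : ℕ} (hk : k ∈ Set.Icc 3 d) (P : ℝ) (q : ℕ) (α : ℝ) :
    WSof d k P q α ≤ 1 := by
  have hB := BkOf_pos (d := d) hk.1
  have hV := VkOf_nonneg hk.2
  exact max_le (Real.rpow_le_one (nint_nonneg _) (nint_le_one _) (by positivity))
    ((min_le_left _ _).trans (inv_le_one_of_one_le₀ (one_le_etaOf (hk.1.trans hk.2) q)))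

lemma MSof_le_one {d : ℕ} (hd : 3 ≤ d) (P : ℝ) (q : ℕ) (α : ℝ) : MSof d P q α ≤ 1 := by
  obtain ⟨k, hk, h⟩ := exists_MSof_eq hd P q α
  exact h ▸ WSof_le_one hk P q α

lemma measurable_WSof (d k : ℕ) (P : ℝ) (q : ℕ) : Measurable (WSof d k P q) := by
  have hm : Measurable fun α : ℝ => nint (q * α) :=
    measurable_nint.comp (measurable_const.mul measurable_id)
  unfold WSof
  exact (hm.pow_const _).max (measurable_const.min
    (Measurable.ite (hm (measurableSet_singleton 0)) measurable_const
      ((hm.mul_const _).pow_const _)))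

lemma measurable_MSof (d : ℕ) (P : ℝ) (q : ℕ) : Measurable (MSof d P q) := by
  unfold MSof
  simp_rw [sInf_image']
  exact Measurable.iInf fun k => measurable_WSof d k P q

lemma CCof_le {d : ℕ} (hd : 3 ≤ d) {P : ℝ} (hP : 1 ≤ P) {q : ℕ} {α : ℝ}
    (hq : (q : ℝ) ≤ P ^ xiOf d) (hα : nint (q * α) ≤ P ^ (-(xiOf d))) :
    CCof d P q α ≤ 2 * P ^ (-(gamOf d)) + (etaOf d q)⁻¹ := by
  have hX := two_le_two_rpow hd
  have hP0 : 0 < P := by linarith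
  have hn := nint_nonneg (q * α)
  have h1 : (nint (q * α) * P) ^ (1 / ((2:ℝ) ^ ((d : ℝ) - 1) - 2)) ≤ P ^ (-(gamOf d)) := by
    rw [two_rpow_sub_one]
    calc _ ≤ (P ^ (-(xiOf d)) * P) ^ (1 / (2 * (2:ℝ) ^ ((d : ℝ) - 2) - 2)) := by
          refine Real.rpow_le_rpow (by positivity) (by gcongr) ?_
          exact (one_div_pos.mpr (by linarith)).le
      _ = P ^ (-(gamOf d)) := by
          nth_rewrite 2 [← Real.rpow_one P]
          rw [← Real.rpow_add hP0, ← Real.rpow_mul hP0.le, xiOf_eq hd, gamOf]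
          congr 1
          set X := (2:ℝ) ^ ((d : ℝ) - 2)
          have h2 : 2 * X - 2 ≠ 0 := by linarith
          rw [neg_add, add_assoc, add_comm, add_assoc, add_neg_cancel, add_zero, neg_mul,
            div_mul_div_comm, mul_comm, mul_div_mul_right _ _ h2]
  have h2 : ((q : ℝ) * P ^ (-(2 : ℝ))) ^ (1 / (2:ℝ) ^ ((d : ℝ) - 2)) ≤ P ^ (-(gamOf d)) := by
    calc _ ≤ (P ^ xiOf d * P ^ (-(2 : ℝ))) ^ (1 / (2:ℝ) ^ ((d : ℝ) - 2)) := by gcongr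
      _ = P ^ (-(gamOf d)) := by
          rw [← Real.rpow_add hP0, ← Real.rpow_mul hP0.le, xiOf_eq hd, gamOf]
          congr 1
          set X := (2:ℝ) ^ ((d : ℝ) - 2)
          have h2 : 3 * X - 2 ≠ 0 := by linarith
          have h3 : X ≠ 0 := by linarith
          rw [mul_one_div, div_eq_iff h3, ← sub_eq_zero]
          have : 1 + (2 * X - 2) / (3 * X - 2) + -2 - -(1 / (3 * X - 2)) * X =
            (3 * X - 2) / (3 * X - 2) - 1 := by ring
          rw [this, div_self h2, sub_self]
  unfold CCof
  linarith

lemma MMof_le_of_lt_etaOf {d : ℕ} (hd : 3 ≤ d) {P : ℝ} (hP : 1 ≤ P) {q : ℕ} {α : ℝ}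
    (hq : (q : ℝ) ≤ P ^ xiOf d) (hα : nint (q * α) ≤ P ^ (-(xiOf d)))
    (hη : P ^ gamOf d < etaOf d q) : MMof d P q α ≤ 3 * P ^ (-(gamOf d)) := by
  have h : (etaOf d q)⁻¹ ≤ P ^ (-(gamOf d)) := by
    rw [Real.rpow_neg (by linarith)]
    exact inv_anti₀ (by positivity) hη.le
  have h' : MMof d P q α ≤ _ := (min_le_left _ _).trans (CCof_le hd hP hq hα)
  linarith

lemma min_inv_etaOf_le {d k : ℕ} (hk : k ∈ Set.Icc 3 d) {P : ℝ} (hP : 1 ≤ P) {q : ℕ}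
    (hq : q ≠ 0) :
    min (etaOf d q)⁻¹ (((q : ℝ) * P ^ (-(k : ℝ))) ^ (1 / BkOf d k)) ≤ P ^ (-(thetaOf d)) := by
  have hd : 3 ≤ d := hk.1.trans hk.2
  have hX := two_le_two_rpow hd
  have hP0 : 0 < P := by linarith
  have hη := one_le_etaOf hd q
  rcases le_total (P ^ thetaOf d) (etaOf d q) with h | h
  · refine min_le_of_left_le ?_
    rw [Real.rpow_neg hP0.le]
    exact inv_anti₀ (by positivity) h
  · refine min_le_of_right_le ?_
    have hB := BkOf_pos (d := d) hk.1
    have hk3 : (3:ℝ) ≤ k := by exact_mod_cast hk.1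
    have hqle : (q : ℝ) ≤ P ^ (thetaOf d * (5 * (2:ℝ) ^ ((d : ℝ) - 2) - 4)) := by
      rw [Real.rpow_mul hP0.le]
      exact (natCast_le_etaOf_rpow hd hq).trans
        (Real.rpow_le_rpow (by linarith) h (by linarith))
    calc _ ≤ (P ^ (thetaOf d * (5 * (2:ℝ) ^ ((d : ℝ) - 2) - 4)) * P ^ (-(k : ℝ))) ^
          (1 / BkOf d k) := by gcongr
      _ = P ^ ((thetaOf d * (5 * (2:ℝ) ^ ((d : ℝ) - 2) - 4) - k) / BkOf d k) := by
          rw [← Real.rpow_add hP0, ← Real.rpow_mul hP0.le, mul_one_div, ← sub_eq_add_neg]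
      _ ≤ P ^ (-(thetaOf d)) := by
          refine Real.rpow_le_rpow_of_exponent_le hP ?_
          rw [div_le_iff₀ hB, BkOf, two_rpow_sub_one, thetaOf]
          set X := (2:ℝ) ^ ((d : ℝ) - 2)
          have h9 : 0 < 9 * X - 4 := by linarith
          have key : 3 * (5 * X - 4) + 3 * ((k - 1) * (2 * X)) ≤ k * (9 * X - 4) := by nlinarith
          have := div_le_of_le_mul₀ h9.le (by linarith) key
          have e : 3 / (9 * X - 4) * (5 * X - 4) + 3 / (9 * X - 4) * ((k - 1) * (2 * X)) =
            (3 * (5 * X - 4) + 3 * ((k - 1) * (2 * X))) / (9 * X - 4) := by ring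
          linarith

lemma min_add_le_add_min {h x y : ℝ} (hh : 0 ≤ h) (hx : 0 ≤ x) (hy : 0 ≤ y) :
    min h (x + y) ≤ min h x + min h y := by
  rcases le_total h x with h1 | h1 <;> rcases le_total h y with h2 | h2 <;>
    simp [h1, h2] <;> first | linarith | exact Or.inl (by linarith)

lemma MMof_le_of_etaOf_le {d : ℕ} (hd : 3 ≤ d) {P : ℝ} (hP : 1 ≤ P) {q : ℕ} (hq0 : q ≠ 0)
    {α : ℝ} (hq : (q : ℝ) ≤ P ^ xiOf d) (hα0 : 0 < nint (q * α))
    (hα : nint (q * α) ≤ P ^ (-(xiOf d))) (hη : etaOf d q ≤ P ^ gamOf d) :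
    MMof d P q α ≤ 6 * (P ^ (-(thetaOf d)) + MSof d P q α) := by
  obtain ⟨k, hk, hkM⟩ := exists_MSof_eq hd P q α
  have hX := two_le_two_rpow hd
  have hP0 : 0 < P := by linarith
  have hη1 := one_le_etaOf hd q
  rw [← hkM]
  set h := (etaOf d q)⁻¹
  have h0 : 0 ≤ h := by positivity
  set a := nint (q * α) ^ (1 / (BkOf d k + VkOf d k))
  set e := ((q : ℝ) * P ^ (-(k : ℝ))) ^ (1 / BkOf d k)
  set m := (nint (q * α) * P ^ (k : ℝ)) ^ (-(1 / BkOf d k))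
  set p := P ^ (-((2:ℝ) ^ (1 - (d : ℝ))))
  have hC : MMof d P q α ≤ 3 * h := by
    have h1 : P ^ (-(gamOf d)) ≤ h := by
      rw [Real.rpow_neg hP0.le]
      exact inv_anti₀ (by positivity) hη
    have h2 : MMof d P q α ≤ _ := (min_le_left _ _).trans (CCof_le hd hP hq hα)
    linarith
  have hW : MMof d P q α ≤ p + a + e + m := by
    refine (MMof_le_WWof hk P q α).trans ?_
    unfold WWof
    rw [if_neg hα0.ne']
    gcongr
    exact min_le_right _ _
  have hS : WSof d k P q α = max a (min h m) := by
    unfold WSof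
    rw [if_neg hα0.ne']
  have hpθ : p ≤ P ^ (-(thetaOf d)) := by
    refine Real.rpow_le_rpow_of_exponent_le hP (neg_le_neg ?_)
    have h1 : (2:ℝ) ^ (1 - (d : ℝ)) = 1 / (2 * (2:ℝ) ^ ((d : ℝ) - 2)) := by
      rw [← two_rpow_sub_one, eq_div_iff (by positivity), ← Real.rpow_add two_pos]
      simp
    rw [h1, thetaOf, div_le_div_iff₀ (by linarith) (by linarith)]
    linarith
  have heθ : min h e ≤ P ^ (-(thetaOf d)) := min_inv_etaOf_le hk hP hq0
  have hp0 : 0 ≤ p := by positivity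
  have ha0 : 0 ≤ a := by positivity
  have he0 : 0 ≤ e := by positivity
  have hm0 : 0 ≤ m := by positivity
  have hmin : min h (p + a + e + m) ≤ min h p + min h a + min h e + min h m := by
    have h1 := min_add_le_add_min h0 hp0 ha0
    have h2 := min_add_le_add_min h0 (add_nonneg hp0 ha0) he0
    have h3 := min_add_le_add_min h0 (add_nonneg (add_nonneg hp0 ha0) he0) hm0
    linarith
  have hM3 : MMof d P q α ≤ 3 * min h (p + a + e + m) := by
    rcases min_choice h (p + a + e + m) with hc | hc <;> rw [hc]
    · exact hC
    · linarith
  have := min_le_right h p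
  have := min_le_right h a
  have := le_max_left a (min h m)
  have := le_max_right a (min h m)
  rw [hS]
  linarith

lemma add_rpow_le_two_rpow_mul {x y s : ℝ} (hx : 0 ≤ x) (hy : 0 ≤ y) (hs : 0 ≤ s) :
    (x + y) ^ s ≤ 2 ^ s * (x ^ s + y ^ s) := by
  calc (x + y) ^ s ≤ (2 * max x y) ^ s := by
        refine Real.rpow_le_rpow (by positivity) ?_ hs
        linarith [le_max_left x y, le_max_right x y]
    _ = 2 ^ s * max x y ^ s := Real.mul_rpow zero_le_two (hx.trans (le_max_left _ _))
    _ ≤ 2 ^ s * (x ^ s + y ^ s) := by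
        have h1 := Real.rpow_nonneg hx s
        have h2 := Real.rpow_nonneg hy s
        gcongr
        rcases max_choice x y with h | h <;> rw [h] <;> linarith

lemma MMof_rpow_le_of_etaOf_le {d : ℕ} (hd : 3 ≤ d) {P : ℝ} (hP : 1 ≤ P) {q : ℕ} (hq0 : q ≠ 0)
    {α s : ℝ} (hs : 0 ≤ s) (hq : (q : ℝ) ≤ P ^ xiOf d) (hα0 : 0 < nint (q * α))
    (hα : nint (q * α) ≤ P ^ (-(xiOf d))) (hη : etaOf d q ≤ P ^ gamOf d) :
    MMof d P q α ^ s ≤ 12 ^ s * ((P ^ (-(thetaOf d))) ^ s + MSof d P q α ^ s) := by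
  have hM := MSof_nonneg d P q α
  calc MMof d P q α ^ s ≤ (6 * (P ^ (-(thetaOf d)) + MSof d P q α)) ^ s :=
        Real.rpow_le_rpow (MMof_nonneg hd hP q α)
          (MMof_le_of_etaOf_le hd hP hq0 hq hα0 hα hη) hs
    _ = 6 ^ s * (P ^ (-(thetaOf d)) + MSof d P q α) ^ s :=
        Real.mul_rpow (by norm_num) (by positivity)
    _ ≤ 6 ^ s * (2 ^ s * ((P ^ (-(thetaOf d))) ^ s + MSof d P q α ^ s)) := by
        gcongr
        exact add_rpow_le_two_rpow_mul (by positivity) hM hs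
    _ = _ := by
        rw [← mul_assoc, ← Real.mul_rpow (by norm_num) (by norm_num)]
        norm_num

/-- The range of integration `{α ∈ [0, 1) : P^{−t} ≤ ‖qα‖ ≤ P^{−ξ}}`. -/
def arcSet (d : ℕ) (t P : ℝ) (q : ℕ) : Set ℝ :=
  {α : ℝ | α ∈ Set.Ico (0 : ℝ) 1 ∧ P ^ (-t) ≤ nint (q * α) ∧ nint (q * α) ≤ P ^ (-(xiOf d))}

lemma measurableSet_arcSet (d : ℕ) (t P : ℝ) (q : ℕ) : MeasurableSet (arcSet d t P q) := by
  have hm : Measurable fun α : ℝ => nint (q * α) :=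
    measurable_nint.comp (measurable_const.mul measurable_id)
  exact measurableSet_Ico.inter ((measurableSet_le measurable_const hm).inter
    (measurableSet_le hm measurable_const))

lemma volume_arcSet_le (d : ℕ) (t : ℝ) {P : ℝ} (hP : 1 ≤ P) {q : ℕ} (hq : q ≠ 0) :
    volume (arcSet d t P q) ≤ ENNReal.ofReal (4 * P ^ (-(xiOf d))) :=
  (measure_mono fun _ (h : _ ∧ _ ∧ _) => And.intro h.1 h.2.2).trans
    (volume_nint_le hq (by positivity))

lemma volume_arcSet_lt_top (d : ℕ) (t : ℝ) {P : ℝ} (hP : 1 ≤ P) {q : ℕ} (hq : q ≠ 0) :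
    volume (arcSet d t P q) < ⊤ :=
  (volume_arcSet_le d t hP hq).trans_lt ENNReal.ofReal_lt_top

lemma volume_real_arcSet_le (d : ℕ) (t : ℝ) {P : ℝ} (hP : 1 ≤ P) {q : ℕ} (hq : q ≠ 0) :
    volume.real (arcSet d t P q) ≤ 4 * P ^ (-(xiOf d)) :=
  ENNReal.toReal_le_of_le_ofReal (by positivity) (volume_arcSet_le d t hP hq)

lemma integrableOn_MSof_rpow {d : ℕ} (hd : 3 ≤ d) (t : ℝ) {P s : ℝ} (hP : 1 ≤ P) (hs : 0 ≤ s)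
    {q : ℕ} (hq : q ≠ 0) :
    IntegrableOn (fun α => MSof d P q α ^ s) (arcSet d t P q) := by
  refine Measure.integrableOn_of_bounded (M := 1) (volume_arcSet_lt_top d t hP hq).ne
    ((measurable_MSof d P q).pow_const s).aestronglyMeasurable (ae_of_all _ fun α => ?_)
  have h := MSof_nonneg d P q α
  rw [Real.norm_of_nonneg (Real.rpow_nonneg h s)]
  exact Real.rpow_le_one h (MSof_le_one hd P q α) hs

lemma setIntegral_MMof_le_of_lt_etaOf {d : ℕ} (hd : 3 ≤ d) (t : ℝ) {P s : ℝ} (hP : 1 ≤ P)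
    (hs : 0 ≤ s) {q : ℕ} (hq0 : q ≠ 0) (hq : (q : ℝ) ≤ P ^ xiOf d)
    (hη : P ^ gamOf d < etaOf d q) :
    ∫ α in arcSet d t P q, MMof d P q α ^ s ≤
      (3 * P ^ (-(gamOf d))) ^ s * (4 * P ^ (-(xiOf d))) := by
  have hfin := volume_arcSet_lt_top d t hP hq0
  calc ∫ α in arcSet d t P q, MMof d P q α ^ s
      ≤ ∫ _ in arcSet d t P q, (3 * P ^ (-(gamOf d))) ^ s := by
        refine integral_mono_of_nonneg (ae_of_all _ fun α =>
          Real.rpow_nonneg (MMof_nonneg hd hP q α) s) (integrableOn_const hfin.ne) ?_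
        filter_upwards [ae_restrict_mem (measurableSet_arcSet d t P q)] with α hα
        exact Real.rpow_le_rpow (MMof_nonneg hd hP q α)
          (MMof_le_of_lt_etaOf hd hP hq hα.2.2 hη) hs
    _ = (3 * P ^ (-(gamOf d))) ^ s * volume.real (arcSet d t P q) := by
        rw [setIntegral_const, smul_eq_mul, mul_comm]
    _ ≤ _ := by
        gcongr
        exact volume_real_arcSet_le d t hP hq0

lemma setIntegral_MMof_le_of_etaOf_le {d : ℕ} (hd : 3 ≤ d) (t : ℝ) {P s : ℝ} (hP : 1 ≤ P)
    (hs : 0 ≤ s) {q : ℕ} (hq0 : q ≠ 0) (hq : (q : ℝ) ≤ P ^ xiOf d)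
    (hη : etaOf d q ≤ P ^ gamOf d) :
    ∫ α in arcSet d t P q, MMof d P q α ^ s ≤
      12 ^ s * ((P ^ (-(thetaOf d))) ^ s * (4 * P ^ (-(xiOf d))) +
        ∫ α in arcSet d t P q, MSof d P q α ^ s) := by
  have hfin := volume_arcSet_lt_top d t hP hq0
  have hc : IntegrableOn (fun _ : ℝ => (P ^ (-(thetaOf d))) ^ s) (arcSet d t P q) :=
    integrableOn_const hfin.ne
  have hM := integrableOn_MSof_rpow hd t hP hs hq0
  calc ∫ α in arcSet d t P q, MMof d P q α ^ s
      ≤ ∫ α in arcSet d t P q, 12 ^ s * ((P ^ (-(thetaOf d))) ^ s + MSof d P q α ^ s) := by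
        refine integral_mono_of_nonneg (ae_of_all _ fun α =>
          Real.rpow_nonneg (MMof_nonneg hd hP q α) s) ((hc.add hM).const_mul _) ?_
        filter_upwards [ae_restrict_mem (measurableSet_arcSet d t P q)] with α hα
        exact MMof_rpow_le_of_etaOf_le hd hP hq0 hs hq
          ((Real.rpow_pos_of_pos (by linarith) _).trans_le hα.2.1) hα.2.2 hη
    _ = 12 ^ s * ((P ^ (-(thetaOf d))) ^ s * volume.real (arcSet d t P q) +
          ∫ α in arcSet d t P q, MSof d P q α ^ s) := by
        rw [integral_const_mul, integral_add hc hM, setIntegral_const, smul_eq_mul, mul_comm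
          (volume.real _)]
    _ ≤ _ := by
        gcongr
        exact volume_real_arcSet_le d t hP hq0

lemma finite_setOf_etaOf_le {d : ℕ} (hd : 3 ≤ d) (R : ℝ) : {q : ℕ | etaOf d q ≤ R}.Finite := by
  have hX := two_le_two_rpow hd
  refine (Set.finite_Iic ⌈R ^ (5 * (2:ℝ) ^ ((d : ℝ) - 2) - 4)⌉₊).subset fun q hq => ?_
  rcases eq_or_ne q 0 with rfl | hq0
  · exact Nat.zero_le _
  have h : (q : ℝ) ≤ R ^ (5 * (2:ℝ) ^ ((d : ℝ) - 2) - 4) :=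
    (natCast_le_etaOf_rpow hd hq0).trans
      (Real.rpow_le_rpow (by linarith [one_le_etaOf hd q]) hq (by linarith))
  exact_mod_cast h.trans (Nat.le_ceil _)

lemma sum_setIntegral_MMof_le {d : ℕ} (hd : 3 ≤ d) (t : ℝ) {P s C ε : ℝ} (hP : 1 ≤ P)
    (hs : 0 ≤ s) (S : Finset ℕ) (hS : ∀ q ∈ S, q ≠ 0 ∧ (q : ℝ) ≤ P ^ xiOf d)
    (hC : ∀ T : Finset ℕ, (∀ q ∈ T, q ≠ 0 ∧ etaOf d q ≤ P ^ gamOf d) →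
      (T.card : ℝ) ≤ C * P ^ (1 + ε)) :
    ∑ q ∈ S, ∫ α in arcSet d t P q, MMof d P q α ^ s ≤
      4 * 3 ^ s * P ^ (-(gamOf d * s)) +
      12 ^ s * 4 * C * P ^ (1 + ε - xiOf d - thetaOf d * s) +
      12 ^ s * ∑' q : ℕ, if 0 < q ∧ P ^ (0:ℝ) ≤ etaOf d q ∧ etaOf d q ≤ P ^ gamOf d then
        ∫ α in arcSet d t P q, MSof d P q α ^ s else 0 := by
  have hP0 : 0 < P := by linarith
  set J : ℕ → ℝ := fun q => ∫ α in arcSet d t P q, MSof d P q α ^ s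
  have hJ : ∀ q, 0 ≤ J q := fun q =>
    integral_nonneg fun α => Real.rpow_nonneg (MSof_nonneg d P q α) s
  set G : ℕ → ℝ := fun q =>
    if 0 < q ∧ P ^ (0:ℝ) ≤ etaOf d q ∧ etaOf d q ≤ P ^ gamOf d then J q else 0 with hG
  have hG0 : ∀ q, 0 ≤ G q := fun q => by
    simp only [hG]
    split_ifs
    exacts [hJ q, le_rfl]
  have hGs : Summable G := by
    refine summable_of_hasFiniteSupport ((finite_setOf_etaOf_le hd (P ^ gamOf d)).subset ?_)
    intro q hq
    by_contra h
    exact hq (if_neg fun hc => h hc.2.2)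
  have hGJ : ∀ q ∈ S, etaOf d q ≤ P ^ gamOf d → G q = J q := fun q hq hη =>
    if_pos ⟨Nat.pos_of_ne_zero (hS q hq).1, by
      rw [Real.rpow_zero]
      exact one_le_etaOf hd q, hη⟩
  rw [← Finset.sum_filter_not_add_sum_filter S (fun q => etaOf d q ≤ P ^ gamOf d), add_assoc]
  refine add_le_add ?_ ?_
  · have hcard : ((S.filter fun q => ¬ etaOf d q ≤ P ^ gamOf d).card : ℝ) ≤ P ^ xiOf d := by
      have hsub : (S.filter fun q => ¬ etaOf d q ≤ P ^ gamOf d) ⊆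
          Finset.Icc 1 ⌊P ^ xiOf d⌋₊ := by
        intro q hq
        have h := hS q (Finset.mem_filter.mp hq).1
        exact Finset.mem_Icc.mpr ⟨Nat.pos_of_ne_zero h.1, Nat.le_floor h.2⟩
      have h := Finset.card_le_card hsub
      rw [Nat.card_Icc, Nat.add_sub_cancel] at h
      exact (Nat.cast_le.mpr h).trans (Nat.floor_le (by positivity))
    calc _ ≤ ∑ q ∈ S.filter fun q => ¬ etaOf d q ≤ P ^ gamOf d,
          (3 * P ^ (-(gamOf d))) ^ s * (4 * P ^ (-(xiOf d))) := by
          refine Finset.sum_le_sum fun q hq => ?_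
          obtain ⟨hqS, hη⟩ := Finset.mem_filter.mp hq
          exact setIntegral_MMof_le_of_lt_etaOf hd t hP hs (hS q hqS).1 (hS q hqS).2
            (not_le.mp hη)
      _ ≤ P ^ xiOf d * ((3 * P ^ (-(gamOf d))) ^ s * (4 * P ^ (-(xiOf d)))) := by
          rw [Finset.sum_const, nsmul_eq_mul]
          gcongr
      _ = 4 * 3 ^ s * P ^ (-(gamOf d * s)) * (P ^ xiOf d * P ^ (-(xiOf d))) := by
          rw [Real.mul_rpow (by norm_num) (by positivity), ← Real.rpow_mul hP0.le, neg_mul]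
          ring
      _ = _ := by
          rw [← Real.rpow_add hP0, add_neg_cancel, Real.rpow_zero, mul_one]
  · have hcard := hC (S.filter fun q => etaOf d q ≤ P ^ gamOf d) fun q hq =>
      ⟨(hS q (Finset.mem_filter.mp hq).1).1, (Finset.mem_filter.mp hq).2⟩
    calc _ ≤ ∑ q ∈ S.filter fun q => etaOf d q ≤ P ^ gamOf d,
          (12 ^ s * ((P ^ (-(thetaOf d))) ^ s * (4 * P ^ (-(xiOf d)))) + 12 ^ s * G q) := by
          refine Finset.sum_le_sum fun q hq => ?_
          obtain ⟨hqS, hη⟩ := Finset.mem_filter.mp hq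
          rw [← mul_add, hGJ q hqS hη]
          exact setIntegral_MMof_le_of_etaOf_le hd t hP hs (hS q hqS).1 (hS q hqS).2 hη
      _ ≤ C * P ^ (1 + ε) * (12 ^ s * ((P ^ (-(thetaOf d))) ^ s * (4 * P ^ (-(xiOf d))))) +
          12 ^ s * ∑' q, G q := by
          rw [Finset.sum_add_distrib, Finset.sum_const, nsmul_eq_mul, ← Finset.mul_sum]
          gcongr
          exact hGs.sum_le_tsum _ fun q _ => hG0 q
      _ = _ := by
          have h : P ^ (1 + ε - xiOf d - thetaOf d * s) =
              P ^ (1 + ε) * P ^ (-(xiOf d)) * (P ^ (-(thetaOf d))) ^ s := by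
            rw [← Real.rpow_mul hP0.le, ← Real.rpow_add hP0, ← Real.rpow_add hP0]
            congr 1
            ring
          rw [h]
          ring

lemma half_le_xiOf_sub_one {d : ℕ} (hd : 3 ≤ d) : 1 / 2 ≤ xiOf d - 1 := by
  have hX := two_le_two_rpow hd
  rw [xiOf_eq hd, add_sub_cancel_left, div_le_div_iff₀ two_pos (by linarith)]
  linarith

lemma natCast_lt_gamOf_mul {d : ℕ} (hd : 3 ≤ d) {s : ℝ}
    (hs : (3 : ℝ) / 4 * d * 2 ^ d - 2 * d < s) : (d : ℝ) < gamOf d * s := by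
  have hX := two_le_two_rpow hd
  have h4 := two_rpow_eq (d : ℝ)
  rw [Real.rpow_natCast] at h4
  rw [h4] at hs
  rw [gamOf, one_div_mul_eq_div, lt_div_iff₀ (by linarith)]
  linarith

lemma natCast_le_thetaOf_mul {d : ℕ} (hd : 3 ≤ d) {s : ℝ}
    (hs : (3 : ℝ) / 4 * d * 2 ^ d - 2 * d < s) : (d : ℝ) - 3 / 7 ≤ thetaOf d * s := by
  have hX := two_le_two_rpow hd
  have hX' := sub_one_le_two_rpow hd
  have hd' : (3:ℝ) ≤ d := by exact_mod_cast hd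
  have h4 := two_rpow_eq (d : ℝ)
  rw [Real.rpow_natCast] at h4
  rw [h4] at hs
  rw [thetaOf, div_mul_eq_mul_div, le_div_iff₀ (by linarith)]
  linarith

/-- Lemma `M to M star lemma`. -/
theorem M_to_M_star (d n : ℕ) (hd : 3 ≤ d)
    (F : MvPolynomial (Fin n) ℤ) (hF : F.IsHomogeneous d)
    (σ : ℕ)
    (hσ : singDim n ℚ (MvPolynomial.map (Int.castRingHom ℚ) F) = (σ : WithBot (WithTop ℕ)))
    (c : ℝ) (cs : ℕ → ℝ) (hc : SuperSeq c cs)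
    (ω : (Fin n → ℝ) → ℝ) (hω : SmoothWeight n c cs ω)
    (Δ : ℝ) (hΔ : 0 < Δ) (hΔ' : Δ < (d : ℝ) / 3)
    (hn : (3 : ℝ) / 4 * d * 2 ^ d - 2 * d < (n : ℝ) - (σ : ℝ)) :
    ∃ δ K : ℝ, 0 < δ ∧ 0 < K ∧
      ∃ Δi di γi : ℝ,
        ((Δi = Δ ∧ di = (d : ℝ) + 2 ∧ γi = Δ / (5 * (2:ℝ) ^ ((d : ℝ) - 2) - 4)) ∨
          (Δi = 0 ∧ di = (d : ℝ) - Δ ∧ γi = 0)) ∧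
        ∀ P : ℝ, 2 ≤ P →
          (∑ q ∈ (Finset.Icc 1 ⌊P ^ xiOf d⌋₊).filter (fun q : ℕ => P ^ Δi ≤ (q : ℝ)),
              ∫ α in {α : ℝ | α ∈ Set.Ico (0 : ℝ) 1 ∧
                  P ^ (-di) ≤ nint (q * α) ∧ nint (q * α) ≤ P ^ (-(xiOf d))},
                (MMof d P q α) ^ ((n : ℝ) - σ)) ≤
            K * (P ^ (-(d : ℝ) - δ) +
              ∑' q : ℕ,
                if 0 < q ∧ P ^ γi ≤ etaOf d q ∧ etaOf d q ≤ P ^ gamOf d then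
                  ∫ α in {α : ℝ | α ∈ Set.Ico (0 : ℝ) 1 ∧
                      P ^ (-di) ≤ nint (q * α) ∧ nint (q * α) ≤ P ^ (-(xiOf d))},
                    (MSof d P q α) ^ ((n : ℝ) - σ)
                else 0) := by
  set s : ℝ := (n : ℝ) - σ
  have hs0 : 0 ≤ s := by
    have h8 : (2:ℝ) ^ 3 ≤ 2 ^ d := pow_le_pow_right₀ one_le_two hd
    have hd0 : (0:ℝ) ≤ d := d.cast_nonneg
    nlinarith
  obtain ⟨C, hC0, hC⟩ := exists_card_etaOf_le (1 / 28) (by norm_num)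
  have hγ := natCast_lt_gamOf_mul hd hn
  have hθ := natCast_le_thetaOf_mul hd hn
  have hξ := half_le_xiOf_sub_one hd
  refine ⟨min (1 / 28) (gamOf d * s - d), 4 * 3 ^ s + 12 ^ s * 4 * C + 12 ^ s,
    lt_min (by norm_num) (by linarith), by positivity, 0, (d : ℝ) - Δ, 0,
    Or.inr ⟨rfl, rfl, rfl⟩, ?_⟩
  intro P hP
  have hP1 : 1 ≤ P := by linarith
  have hδ1 := min_le_left (1 / 28) (gamOf d * s - d)
  have hδ2 := min_le_right (1 / 28) (gamOf d * s - d)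
  set δ := min (1 / 28) (gamOf d * s - d)
  have hsum := sum_setIntegral_MMof_le hd ((d : ℝ) - Δ) hP1 hs0
    ((Finset.Icc 1 ⌊P ^ xiOf d⌋₊).filter (fun q : ℕ => P ^ (0:ℝ) ≤ (q : ℝ)))
    (fun q hq => by
      have h := Finset.mem_Icc.mp (Finset.mem_filter.mp hq).1
      exact ⟨Nat.one_le_iff_ne_zero.mp h.1, (Nat.le_floor_iff (by positivity)).mp h.2⟩)
    (hC d hd P hP1)
  refine hsum.trans ?_
  have h1 : P ^ (-(gamOf d * s)) ≤ P ^ (-(d : ℝ) - δ) :=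
    Real.rpow_le_rpow_of_exponent_le hP1 (by linarith)
  have h2 : P ^ (1 + 1 / 28 - xiOf d - thetaOf d * s) ≤ P ^ (-(d : ℝ) - δ) :=
    Real.rpow_le_rpow_of_exponent_le hP1 (by linarith)
  simp only [arcSet]
  set T := ∑' q : ℕ, if 0 < q ∧ P ^ (0:ℝ) ≤ etaOf d q ∧ etaOf d q ≤ P ^ gamOf d then
      ∫ α in {α : ℝ | α ∈ Set.Ico (0 : ℝ) 1 ∧
          P ^ (-((d : ℝ) - Δ)) ≤ nint (q * α) ∧ nint (q * α) ≤ P ^ (-(xiOf d))},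
        (MSof d P q α) ^ s
    else 0
  have hT0 : 0 ≤ T := tsum_nonneg fun q => by
    split_ifs
    exacts [integral_nonneg fun α => Real.rpow_nonneg (MSof_nonneg d P q α) s, le_rfl]
  have h3 : 0 ≤ P ^ (-(d : ℝ) - δ) := by positivity
  calc _ ≤ 4 * 3 ^ s * P ^ (-(d : ℝ) - δ) + 12 ^ s * 4 * C * P ^ (-(d : ℝ) - δ) +
        12 ^ s * T := by gcongr
    _ ≤ _ := by
        have : 0 ≤ (4 * 3 ^ s + 12 ^ s * 4 * C) * T + 12 ^ s * P ^ (-(d : ℝ) - δ) := by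
          positivity
        linarith

end
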